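/- Let r > 0 and x₀ ∈ ℝ, and set χ(x) = (1/√r) tanh(√r (x − x₀)). Then the pair (φ, χ) with φ ≡ 0 is a C² solution on ℝ of the second-order system ½φ'' = (φ² + r(1 + 2r)χ² − 1)φ, ½χ'' = r(rχ² − 1 + (1 + 2r)φ²)χ, satisfying χ(x) → ∓1/√r as x → ∓∞; moreover (φ, χ) does NOT satisfy the BPS equations (φ', χ') = ±(φ² + rχ² − 1, 2rφχ) (for either sign). Hence this is a finite-energy non-BPS domain wall linking the ground states (0, −1/√r) and (0, 1/√r). -/

import Mathlib

open Filter

theorem Real.hasDerivAt_tanh (x : ℝ) :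
    HasDerivAt Real.tanh (1 - Real.tanh x ^ 2) x := by
  have hc : Real.cosh x ≠ 0 := (Real.cosh_pos x).ne'
  have h := (Real.hasDerivAt_sinh x).div (Real.hasDerivAt_cosh x) hc
  have htanh : Real.tanh = Real.sinh / Real.cosh := funext Real.tanh_eq_sinh_div_cosh
  have hval : (Real.cosh x * Real.cosh x - Real.sinh x * Real.sinh x) / Real.cosh x ^ 2 =
      1 - Real.tanh x ^ 2 := by
    rw [Real.tanh_eq_sinh_div_cosh]
    field_simp
  rwa [hval, ← htanh] at h

theorem Real.contDiff_tanh {n : WithTop ℕ∞} : ContDiff ℝ n Real.tanh := by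
  have htanh : Real.tanh = fun x => Real.sinh x / Real.cosh x :=
    funext Real.tanh_eq_sinh_div_cosh
  rw [htanh]
  exact Real.contDiff_sinh.div Real.contDiff_cosh fun x => (Real.cosh_pos x).ne'

theorem Real.tendsto_tanh_atTop : Tendsto Real.tanh atTop (nhds 1) := by
  have htanh : Real.tanh = fun x => 1 - 2 / (Real.exp (2 * x) + 1) := by
    funext x
    rw [Real.tanh_eq, Real.exp_neg, two_mul, Real.exp_add]
    have := Real.exp_pos x
    field_simp
    ring
  have hexp : Tendsto (fun x : ℝ => Real.exp (2 * x) + 1) atTop atTop :=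
    tendsto_atTop_add_const_right _ _
      (Real.tendsto_exp_atTop.comp (tendsto_id.const_mul_atTop two_pos))
  rw [htanh]
  simpa using (hexp.const_div_atTop 2).const_sub 1

theorem Real.tendsto_tanh_atBot : Tendsto Real.tanh atBot (nhds (-1)) := by
  have h := (Real.tendsto_tanh_atTop.comp tendsto_neg_atBot_atTop).neg
  refine h.congr fun x => ?_
  simp

/-- For `r > 0`, the pair `φ ≡ 0`, `χ(x) = (1/√r)·tanh(√r(x - x₀))` is a `C²`
solution of the second-order system `½φ'' = (φ² + r(1+2r)χ² − 1)φ`,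
`½χ'' = r(rχ² − 1 + (1+2r)φ²)χ` linking `(0, -1/√r)` to `(0, 1/√r)`, which does NOT
satisfy the BPS equations `(φ', χ') = ±(φ² + rχ² − 1, 2rφχ)` for either sign. -/
theorem two_field_non_bps_solution (r : ℝ) (hr : 0 < r) (x₀ : ℝ) :
    let φ : ℝ → ℝ := fun _ => 0
    let χ : ℝ → ℝ := fun x => (1 / Real.sqrt r) * Real.tanh (Real.sqrt r * (x - x₀))
    ContDiff ℝ 2 φ ∧ ContDiff ℝ 2 χ ∧
    (∀ x : ℝ, (1 / 2) * deriv (deriv φ) x =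
      ((φ x) ^ 2 + r * (1 + 2 * r) * (χ x) ^ 2 - 1) * φ x) ∧
    (∀ x : ℝ, (1 / 2) * deriv (deriv χ) x =
      r * (r * (χ x) ^ 2 - 1 + (1 + 2 * r) * (φ x) ^ 2) * χ x) ∧
    Tendsto χ atBot (nhds (-(1 / Real.sqrt r))) ∧
    Tendsto χ atTop (nhds (1 / Real.sqrt r)) ∧
    ¬ ((∀ x : ℝ, deriv φ x = (φ x) ^ 2 + r * (χ x) ^ 2 - 1 ∧
          deriv χ x = 2 * r * φ x * χ x) ∨
       (∀ x : ℝ, deriv φ x = -((φ x) ^ 2 + r * (χ x) ^ 2 - 1) ∧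
          deriv χ x = -(2 * r * φ x * χ x))) := by
  intro φ χ
  have hs : 0 < Real.sqrt r := Real.sqrt_pos.2 hr
  have hsq : Real.sqrt r ^ 2 = r := Real.sq_sqrt hr.le
  have hd (x : ℝ) : HasDerivAt (fun y => Real.tanh (Real.sqrt r * (y - x₀)))
      ((1 - Real.tanh (Real.sqrt r * (x - x₀)) ^ 2) * Real.sqrt r) x := by
    have hlin : HasDerivAt (fun y => Real.sqrt r * (y - x₀)) (Real.sqrt r) x := by
      simpa using ((hasDerivAt_id x).sub_const x₀).const_mul (Real.sqrt r)
    exact (Real.hasDerivAt_tanh _).comp x hlin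
  have hχ' : deriv χ = fun x => 1 - Real.tanh (Real.sqrt r * (x - x₀)) ^ 2 := by
    funext x
    rw [((hd x).const_mul (1 / Real.sqrt r)).deriv]
    field_simp
  refine ⟨contDiff_const, ?_, ?_, ?_, ?_, ?_, ?_⟩
  · exact contDiff_const.mul (Real.contDiff_tanh.comp (by fun_prop))
  · simp [φ]
  · intro x
    have hd2 : HasDerivAt (deriv χ) _ x := hχ' ▸ ((hd x).pow 2).const_sub 1
    rw [hd2.deriv]
    simp only [φ, χ]
    generalize Real.tanh (Real.sqrt r * (x - x₀)) = t
    generalize Real.sqrt r = s at hs hsq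
    subst hsq
    field_simp
    push_cast
    ring
  · have hlin : Tendsto (fun x => Real.sqrt r * (x - x₀)) atBot atBot :=
      (tendsto_atBot_add_const_right _ (-x₀) tendsto_id).const_mul_atBot hs
    simpa [χ] using (Real.tendsto_tanh_atBot.comp hlin).const_mul (1 / Real.sqrt r)
  · have hlin : Tendsto (fun x => Real.sqrt r * (x - x₀)) atTop atTop :=
      (tendsto_atTop_add_const_right _ (-x₀) tendsto_id).const_mul_atTop hs
    simpa [χ] using (Real.tendsto_tanh_atTop.comp hlin).const_mul (1 / Real.sqrt r)
  · rintro (h | h)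
    · simpa [φ, χ] using (h x₀).1
    · simpa [φ, χ] using (h x₀).1
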